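/- arXiv:1303.6341 — 2 statements merged into one kernel-verified Lean document; each statement's English description precedes it below -/
import Mathlib

section
/- Let n ≥ 1, p ≥ 0, let π ∈ NC_n with a = π⁺ ∈ NC_n^+, and set ⟨a⟩^p = (1, 2, …, p, p+a_1, …, p+a_n), which belongs to NC_{n+p}^+. For τ ∈ NC_n let ⟨τ⟩^p ∈ NC_{n+p} denote the p-nesting of τ, which matches i with 2(n+p)+1−i for each 1 ≤ i ≤ p and matches p+i with p+j if and only if τ matches i with j. Then for every σ ∈ NC_{n+p}: C_{⟨a⟩^p, σ} = C_{a,τ} if σ = ⟨τ⟩^p for some τ ∈ NC_n, and C_{⟨a⟩^p, σ} = 0 if σ is not a p-nesting of any element of NC_n. -/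
open scoped BigOperators

open MvPolynomial

attribute [local instance 10] Classical.propDecidable

/-- A noncrossing matching of order `n`, on the points `0, …, 2n-1`
(representing the 1-indexed points `1, …, 2n`): a fixed-point-free involution
with no crossing `a < b < c < d`, `f a = c`, `f b = d`. -/
structure NCM (n : ℕ) where
  f : Fin (2 * n) → Fin (2 * n)
  invol : ∀ k, f (f k) = k
  nofix : ∀ k, f k ≠ k
  noncross : ∀ a b c d : Fin (2 * n), a < b → b < c → c < d → f a = c → f b = d → False

theorem NCM.ext' {n : ℕ} {π σ : NCM n} (h : π.f = σ.f) : π = σ := by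
  cases π; cases σ; simpa using h

noncomputable instance {n : ℕ} : Fintype (NCM n) :=
  Fintype.ofInjective NCM.f fun _ _ h => NCM.ext' h

/-- `q = e^{2πi/3}`. -/
noncomputable def q : ℂ := Complex.exp (2 * Real.pi * Complex.I / 3)

/-- A wheel polynomial of order `n`: homogeneous of total degree `n(n-1)` and
vanishing under every substitution `z_j := q² z_i`, `z_k := q⁴ z_i` for `i < j < k`. -/
def IsWheel (n : ℕ) (p : MvPolynomial (Fin (2 * n)) ℂ) : Prop :=
  p.IsHomogeneous (n * (n - 1)) ∧
  ∀ i j k : Fin (2 * n), i < j → j < k →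
    (aeval fun l : Fin (2 * n) =>
      if l = j then C (q ^ 2) * X i
      else if l = k then C (q ^ 4) * X i
      else (X l : MvPolynomial (Fin (2 * n)) ℂ)) p = 0

/-- The `π`-evaluation `p(π) = p(q^{-π_1}, …, q^{-π_{2n}})`, where the `k`-th coordinate
is `q⁻¹` if `π` matches `k` to the right and `q` if it matches `k` to the left. -/
noncomputable def evalNC {n : ℕ} (p : MvPolynomial (Fin (2 * n)) ℂ) (π : NCM n) : ℂ :=
  eval (fun k => if k < π.f k then q⁻¹ else q) p

/-- Evaluation of a polynomial with all variables set to `1`. -/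
noncomputable def evalOne {n : ℕ} (p : MvPolynomial (Fin (2 * n)) ℂ) : ℂ :=
  eval (fun _ => (1 : ℂ)) p

/-- The alternating sign matrix numbers `ASM(n) = ∏_{j=0}^{n-1} (3j+1)!/(n+j)!`. -/
noncomputable def ASM (n : ℕ) : ℂ :=
  ∏ j ∈ Finset.range n, ((3 * j + 1).factorial : ℂ) / ((n + j).factorial : ℂ)

/-- Cyclic successor on `Fin m`. -/
def fsucc {m : ℕ} (k : Fin m) : Fin m := ⟨((k : ℕ) + 1) % m, Nat.mod_lt _ k.pos⟩

/-- The Temperley–Lieb operator `e_k` (underlying function on points): if `π` matches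
`k` with `k+1` it is `π`; otherwise it matches `k ↔ k+1`, `π(k) ↔ π(k+1)` and agrees
with `π` elsewhere (indices cyclic modulo `2n`). -/
def eRaw {n : ℕ} (k : Fin (2 * n)) (π : NCM n) : Fin (2 * n) → Fin (2 * n) :=
  if π.f k = fsucc k then π.f
  else fun m =>
    if m = k then fsucc k
    else if m = fsucc k then k
    else if m = π.f k then π.f (fsucc k)
    else if m = π.f (fsucc k) then π.f k
    else π.f m

/-- The stationarity linear system `2n·v_π = Σ_{k=1}^{2n} Σ_{π' : e_k(π') = π} v_{π'}`. -/
def Stationary {n : ℕ} (v : NCM n → ℂ) : Prop :=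
  ∀ π : NCM n, ((2 * n : ℕ) : ℂ) * v π =
    ∑ k : Fin (2 * n), ∑ π' : NCM n, if eRaw k π' = π.f then v π' else 0

/-- A fixed-point-free involution on `2n` points has exactly `n` "openers". -/
theorem card_openers {n : ℕ} (π : NCM n) :
    (Finset.univ.filter fun k => k < π.f k).card = n := by
  classical
  have hcard : (Finset.univ.filter fun k : Fin (2 * n) => k < π.f k).card
      = (Finset.univ.filter fun k : Fin (2 * n) => π.f k < k).card := by
    apply Finset.card_bij (fun a _ => π.f a)
    · intro a ha
      simp only [Finset.mem_filter, Finset.mem_univ, true_and] at ha ⊢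
      rw [π.invol]; exact ha
    · intro a ha b hb hab
      have h := congrArg π.f hab
      rwa [π.invol, π.invol] at h
    · intro b hb
      simp only [Finset.mem_filter, Finset.mem_univ, true_and] at hb
      refine ⟨π.f b, ?_, π.invol b⟩
      simp only [Finset.mem_filter, Finset.mem_univ, true_and]
      rw [π.invol]; exact hb
  have hdisj : Disjoint (Finset.univ.filter fun k : Fin (2 * n) => k < π.f k)
      (Finset.univ.filter fun k : Fin (2 * n) => π.f k < k) := by
    rw [Finset.disjoint_left]
    intro a haA haB
    simp only [Finset.mem_filter, Finset.mem_univ, true_and] at haA haB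
    exact absurd (haA.trans haB) (lt_irrefl a)
  have hunion : (Finset.univ.filter fun k : Fin (2 * n) => k < π.f k)
      ∪ (Finset.univ.filter fun k : Fin (2 * n) => π.f k < k) = Finset.univ := by
    ext a
    simp only [Finset.mem_union, Finset.mem_filter, Finset.mem_univ, true_and, iff_true]
    rcases lt_trichotomy a (π.f a) with h | h | h
    · exact Or.inl h
    · exact absurd h.symm (π.nofix a)
    · exact Or.inr h
  have hc := Finset.card_union_of_disjoint hdisj
  rw [hunion, Finset.card_univ, Fintype.card_fin] at hc
  omega

/-- `π⁺ : Fin n → ℕ`, the increasing enumeration (with 1-indexed values) of the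
set of points matched to the right by `π`. -/
noncomputable def plus {n : ℕ} (π : NCM n) : Fin n → ℕ := fun i =>
  ((((Finset.univ.filter fun k => k < π.f k).orderIsoOfFin (card_openers π) i :
      { x // x ∈ Finset.univ.filter fun k => k < π.f k }) : Fin (2 * n)) : ℕ) + 1

/-- `χ(m) = 0, 1, -1` according as `m ≡ 0, 1, 2 (mod 3)`. -/
def chi (m : ℤ) : ℤ := if m % 3 = 0 then 0 else if m % 3 = 1 then 1 else -1

/-- `p_{j,k}(a) = #{m : j ≤ a_m < k} − (k−j−1)/2` (arguments `j`, `k` 1-indexed). -/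
def pjkSeq {N : ℕ} (a : Fin N → ℕ) (j k : ℕ) : ℤ :=
  ((Finset.univ.filter fun m : Fin N => j ≤ a m ∧ a m < k).card : ℤ)
    - (((k - j - 1) / 2 : ℕ) : ℤ)

/-- `C_{a,σ} = ∏_{j<k matched by σ} χ(p_{j,k}(a))`. -/
noncomputable def CmatSeq {N n : ℕ} (a : Fin N → ℕ) (σ : NCM n) : ℤ :=
  ∏ j : Fin (2 * n), ∏ k : Fin (2 * n),
    if j < k ∧ σ.f j = k then chi (pjkSeq a ((j : ℕ) + 1) ((k : ℕ) + 1)) else 1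

/-- `σ` is the `p`-nesting of `τ`: `σ` matches `i` with `2(n+p)+1-i` for `1 ≤ i ≤ p`
and matches `p+i` with `p+j` iff `τ` matches `i` with `j` (1-indexed description;
here everything is 0-indexed). -/
def IsNest (p : ℕ) {n : ℕ} (τ : NCM n) (σ : NCM (n + p)) : Prop :=
  (∀ i : Fin (2 * (n + p)), (i : ℕ) < p →
    (σ.f i : ℕ) = 2 * (n + p) - 1 - (i : ℕ)) ∧
  ∀ i : Fin (2 * n),
    (σ.f ⟨p + (i : ℕ), by have := i.isLt; omega⟩ : ℕ) = p + (τ.f i : ℕ)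

/-- The `p`-nested sequence `⟨a⟩^p = (1, 2, …, p, p+a_1, …, p+a_n)` with `a = π⁺`. -/
noncomputable def nestSeq (p : ℕ) {n : ℕ} (π : NCM n) : Fin (n + p) → ℕ := fun i =>
  if h : (i : ℕ) < p then (i : ℕ) + 1
  else p + plus π ⟨(i : ℕ) - p, by have := i.isLt; omega⟩

/-- Number of entries of `a` in `[x+1, y+1)`. -/
def cntSeq {N : ℕ} (a : Fin N → ℕ) (x y : ℕ) : ℕ :=
  (Finset.univ.filter fun m : Fin N => x + 1 ≤ a m ∧ a m < y + 1).card

theorem pjk_cnt {N : ℕ} (a : Fin N → ℕ) (x y : ℕ) :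
    pjkSeq a (x + 1) (y + 1) = (cntSeq a x y : ℤ) - (((y - x - 1) / 2 : ℕ) : ℤ) := by
  unfold pjkSeq cntSeq
  have : y + 1 - (x + 1) - 1 = y - x - 1 := by omega
  rw [this]

theorem cnt_add {N : ℕ} (a : Fin N → ℕ) {x y z : ℕ} (h1 : x ≤ y) (h2 : y ≤ z) :
    cntSeq a x z = cntSeq a x y + cntSeq a y z := by
  unfold cntSeq
  rw [← Finset.card_union_of_disjoint]
  · congr 1
    ext m
    simp only [Finset.mem_filter, Finset.mem_univ, true_and, Finset.mem_union]
    omega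
  · rw [Finset.disjoint_left]
    intro m
    simp only [Finset.mem_filter, Finset.mem_univ, true_and]
    omega

theorem NCM.inj {n : ℕ} (σ : NCM n) {i j : Fin (2 * n)} (h : σ.f i = σ.f j) : i = j := by
  have := congrArg σ.f h
  rwa [σ.invol, σ.invol] at this

theorem NCM.inside {n : ℕ} (σ : NCM n) {j i : Fin (2 * n)} (h1 : j < i)
    (h2 : i < σ.f j) : j < σ.f i ∧ σ.f i < σ.f j := by
  have a1 : σ.f i ≠ j := by
    intro h
    have := σ.invol i
    rw [h] at this
    exact absurd this (ne_of_gt h2)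
  have a2 : σ.f i ≠ σ.f j := fun h => absurd (σ.inj h) (ne_of_gt h1)
  constructor
  · by_contra h
    exact σ.noncross (σ.f i) j i (σ.f j) (lt_of_le_of_ne (not_lt.1 h) a1) h1 h2 (σ.invol i) rfl
  · by_contra h
    exact σ.noncross j i (σ.f j) (σ.f i) h1 h2 (lt_of_le_of_ne (not_lt.1 h) a2.symm) rfl rfl

theorem sat_count {N n : ℕ} (σ : NCM n) (a : Fin N → ℕ)
    (h : ∀ j : Fin (2 * n), j < σ.f j → pjkSeq a ((j : ℕ) + 1) ((σ.f j : ℕ) + 1) ≠ 0) :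
    ∀ d x y : ℕ, y = x + d → y ≤ 2 * n →
      (∀ i : Fin (2 * n), x ≤ (i : ℕ) → (i : ℕ) < y →
        x ≤ (σ.f i : ℕ) ∧ (σ.f i : ℕ) < y) →
      ∃ e, d = 2 * e ∧ e ≤ cntSeq a x y := by
  intro d
  induction d using Nat.strong_induction_on with
  | _ d ih =>
    intro x y hy hyn hs
    rcases Nat.eq_zero_or_pos d with h0 | hd
    · exact ⟨0, by omega, by omega⟩
    have hx : x < 2 * n := by omega
    obtain ⟨j, hj⟩ : ∃ j : Fin (2 * n), (j : ℕ) = x := ⟨⟨x, hx⟩, rfl⟩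
    have hk := hs j (by omega) (by omega)
    have hne : (σ.f j : ℕ) ≠ x := by
      intro h'
      exact σ.nofix j (Fin.ext (by omega))
    have hjk : j < σ.f j := by rw [Fin.lt_def]; omega
    have hp := h j hjk
    rw [pjk_cnt, hj] at hp
    obtain ⟨e1, he1, hc1⟩ := ih ((σ.f j : ℕ) - (x + 1)) (by omega) (x + 1) (σ.f j : ℕ)
      (by omega) (by omega) (by
        intro i hi1 hi2
        have := σ.inside (j := j) (i := i) (by rw [Fin.lt_def]; omega) (by rw [Fin.lt_def]; omega)
        rw [Fin.lt_def, Fin.lt_def] at this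
        omega)
    obtain ⟨e2, he2, hc2⟩ := ih (y - ((σ.f j : ℕ) + 1)) (by omega) ((σ.f j : ℕ) + 1) y
      (by omega) (by omega) (by
        intro i hi1 hi2
        have hb := hs i (by omega) hi2
        refine ⟨?_, hb.2⟩
        by_contra hcon
        have c1 : (σ.f i : ℕ) ≠ (σ.f j : ℕ) := by
          intro h'
          have := σ.inj (Fin.ext h')
          subst this
          omega
        have c2 : (σ.f i : ℕ) ≠ (j : ℕ) := by
          intro h'
          have h3 := σ.invol i
          rw [Fin.ext h'] at h3
          have := congrArg Fin.val h3
          omega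
        have := σ.inside (j := j) (i := σ.f i) (by rw [Fin.lt_def]; omega)
          (by rw [Fin.lt_def]; omega)
        rw [σ.invol, Fin.lt_def, Fin.lt_def] at this
        omega)
    have s1 := cnt_add a (x := x) (y := x + 1) (z := (σ.f j : ℕ)) (by omega) (by omega)
    have s2 := cnt_add a (x := x) (y := (σ.f j : ℕ)) (z := y) (by omega) (by omega)
    have s3 := cnt_add a (x := (σ.f j : ℕ)) (y := (σ.f j : ℕ) + 1) (z := y) (by omega) (by omega)
    exact ⟨e1 + e2 + 1, by omega, by omega⟩

theorem arc_count {N n : ℕ} (σ : NCM n) (a : Fin N → ℕ)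
    (h : ∀ j : Fin (2 * n), j < σ.f j → pjkSeq a ((j : ℕ) + 1) ((σ.f j : ℕ) + 1) ≠ 0)
    (j : Fin (2 * n)) (hj : j < σ.f j) :
    (σ.f j : ℕ) - (j : ℕ) + 1 ≤ 2 * cntSeq a j (σ.f j) := by
  have hp := h j hj
  rw [pjk_cnt] at hp
  rw [Fin.lt_def] at hj
  obtain ⟨e1, he1, hc1⟩ := sat_count σ a h ((σ.f j : ℕ) - ((j : ℕ) + 1)) ((j : ℕ) + 1) (σ.f j : ℕ)
      (by omega) (by omega) (by
        intro i hi1 hi2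
        have := σ.inside (j := j) (i := i) (by rw [Fin.lt_def]; omega) (by rw [Fin.lt_def]; omega)
        rw [Fin.lt_def, Fin.lt_def] at this
        omega)
  have s1 := cnt_add a (x := (j : ℕ)) (y := (j : ℕ) + 1) (z := (σ.f j : ℕ)) (by omega) (by omega)
  omega

theorem Cmat_single {N n : ℕ} (a : Fin N → ℕ) (σ : NCM n) :
    CmatSeq a σ = ∏ j : Fin (2 * n),
      if j < σ.f j then chi (pjkSeq a ((j : ℕ) + 1) ((σ.f j : ℕ) + 1)) else 1 := by
  unfold CmatSeq
  refine Finset.prod_congr rfl fun j _ => ?_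
  rw [Finset.prod_eq_single (σ.f j)]
  · simp
  · intro k _ hk
    rw [if_neg]
    rintro ⟨_, h⟩
    exact hk h.symm
  · simp

theorem card_fin_ge (p x : ℕ) :
    (Finset.univ.filter fun i : Fin p => x ≤ (i : ℕ)).card = p - x := by
  have : (Finset.univ.filter fun i : Fin p => x ≤ (i : ℕ)).map Fin.valEmbedding
      = Finset.Ico x p := by
    ext k
    simp only [Finset.mem_map, Finset.mem_filter, Finset.mem_univ, true_and,
      Fin.valEmbedding_apply, Finset.mem_Ico]
    constructor
    · rintro ⟨i, h, rfl⟩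
      exact ⟨h, i.isLt⟩
    · rintro ⟨h1, h2⟩
      exact ⟨⟨k, h2⟩, h1, rfl⟩
  rw [← Finset.card_map Fin.valEmbedding, this, Nat.card_Ico]

theorem card_nest (p : ℕ) {n : ℕ} (π : NCM n) (P : ℕ → Prop) [DecidablePred P] :
    (Finset.univ.filter fun m : Fin (n + p) => P (nestSeq p π m)).card
      = (Finset.univ.filter fun i : Fin p => P ((i : ℕ) + 1)).card
        + (Finset.univ.filter fun i : Fin n => P (p + plus π i)).card := by
  simp only [Finset.card_filter]
  rw [← Equiv.sum_comp (finCongr (Nat.add_comm p n)), Fin.sum_univ_add]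
  congr 1
  · refine Finset.sum_congr rfl fun i _ => ?_
    have : nestSeq p π (finCongr (Nat.add_comm p n) (Fin.castAdd n i)) = (i : ℕ) + 1 := by
      simp [nestSeq]
    rw [this]
  · refine Finset.sum_congr rfl fun i _ => ?_
    have : nestSeq p π (finCongr (Nat.add_comm p n) (Fin.natAdd p i)) = p + plus π i := by
      simp [nestSeq]
    rw [this]

theorem plus_spec {n : ℕ} (π : NCM n) : ∃ o : Fin n → Fin (2 * n),
    Function.Injective o ∧ (∀ i, o i < π.f (o i)) ∧ ∀ i, plus π i = (o i : ℕ) + 1 := by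
  refine ⟨fun i => (((Finset.univ.filter fun k => k < π.f k).orderIsoOfFin (card_openers π) i :
      { x // x ∈ Finset.univ.filter fun k => k < π.f k }) : Fin (2 * n)), ?_, ?_, fun i => rfl⟩
  · intro i j h
    exact (OrderIso.injective _) (Subtype.ext h)
  · intro i
    have := ((Finset.univ.filter fun k => k < π.f k).orderIsoOfFin (card_openers π) i).2
    exact (Finset.mem_filter.1 this).2

theorem plus_pos {n : ℕ} (π : NCM n) (i : Fin n) : 1 ≤ plus π i := by
  obtain ⟨o, _, _, h⟩ := plus_spec π
  rw [h]; omega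

theorem plus_le {n : ℕ} (π : NCM n) (i : Fin n) : plus π i ≤ 2 * n := by
  obtain ⟨o, _, _, h⟩ := plus_spec π
  rw [h]; have := (o i).isLt; omega

theorem plus_ballot {n : ℕ} (π : NCM n) (x : ℕ) :
    2 * (Finset.univ.filter fun i : Fin n => x + 1 ≤ plus π i).card ≤ 2 * n - x := by
  obtain ⟨o, ho, hlt, h⟩ := plus_spec π
  set S := Finset.univ.filter fun i : Fin n => x + 1 ≤ plus π i with hS
  have hS' : ∀ i ∈ S, x ≤ (o i : ℕ) := by
    intro i hi
    have := (Finset.mem_filter.1 hi).2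
    rw [h] at this; omega
  have c1 : (S.image o).card = S.card := Finset.card_image_of_injective _ ho
  have c2 : (S.image fun i => π.f (o i)).card = S.card :=
    Finset.card_image_of_injective _ fun i j hij => ho (π.inj hij)
  have hd : Disjoint (S.image o) (S.image fun i => π.f (o i)) := by
    rw [Finset.disjoint_left]
    intro k hk hk'
    obtain ⟨i, _, rfl⟩ := Finset.mem_image.1 hk
    obtain ⟨j, _, hj⟩ := Finset.mem_image.1 hk'
    have h1 := hlt i
    have h2 := hlt j
    rw [← hj, π.invol] at h1
    exact absurd (h1.trans h2) (lt_irrefl _)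
  have hc := Finset.card_union_of_disjoint hd
  have hsub : S.image o ∪ (S.image fun i => π.f (o i))
      ⊆ Finset.univ.filter fun k : Fin (2 * n) => x ≤ (k : ℕ) := by
    intro k hk
    rw [Finset.mem_filter]
    refine ⟨Finset.mem_univ _, ?_⟩
    rcases Finset.mem_union.1 hk with hk | hk
    · obtain ⟨i, hi, rfl⟩ := Finset.mem_image.1 hk
      exact hS' i hi
    · obtain ⟨i, hi, rfl⟩ := Finset.mem_image.1 hk
      have h1 := hS' i hi
      have h2 := hlt i
      rw [Fin.lt_def] at h2
      omega
  have := Finset.card_le_card hsub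
  rw [card_fin_ge] at this
  omega

theorem cnt_nest (p : ℕ) {n : ℕ} (π : NCM n) (x y : ℕ) :
    cntSeq (nestSeq p π) x y
      = (Finset.univ.filter fun i : Fin p => x + 1 ≤ (i : ℕ) + 1 ∧ (i : ℕ) + 1 < y + 1).card
        + (Finset.univ.filter fun i : Fin n =>
            x + 1 ≤ p + plus π i ∧ p + plus π i < y + 1).card :=
  card_nest p π fun v => x + 1 ≤ v ∧ v < y + 1

theorem cnt_nest_mid (p : ℕ) {n : ℕ} (π : NCM n) (x y : ℕ) :
    cntSeq (nestSeq p π) (p + x) (p + y) = cntSeq (plus π) x y := by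
  rw [cnt_nest]
  have : (Finset.univ.filter fun i : Fin p =>
      p + x + 1 ≤ (i : ℕ) + 1 ∧ (i : ℕ) + 1 < p + y + 1) = ∅ := by
    ext i
    have := i.isLt
    simp only [Finset.mem_filter, Finset.mem_univ, true_and, Finset.notMem_empty, iff_false]
    omega
  rw [this, Finset.card_empty, Nat.zero_add]
  unfold cntSeq
  congr 1
  ext i
  simp only [Finset.mem_filter, Finset.mem_univ, true_and]
  omega

theorem cnt_nest_out (p : ℕ) {n : ℕ} (π : NCM n) (x y : ℕ) (hx : x < p) (hy : p + 2 * n ≤ y) :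
    cntSeq (nestSeq p π) x y = n + (p - x) := by
  rw [cnt_nest]
  have e1 : (Finset.univ.filter fun i : Fin p =>
      x + 1 ≤ (i : ℕ) + 1 ∧ (i : ℕ) + 1 < y + 1)
      = Finset.univ.filter fun i : Fin p => x ≤ (i : ℕ) := by
    ext i
    have := i.isLt
    simp only [Finset.mem_filter, Finset.mem_univ, true_and]
    omega
  have e2 : (Finset.univ.filter fun i : Fin n =>
      x + 1 ≤ p + plus π i ∧ p + plus π i < y + 1) = Finset.univ := by
    ext i
    have := plus_le π i
    have := plus_pos π i
    simp only [Finset.mem_filter, Finset.mem_univ, true_and, iff_true]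
    omega
  rw [e1, e2, card_fin_ge, Finset.card_univ, Fintype.card_fin, Nat.add_comm]

theorem cnt_nest_le (p : ℕ) {n : ℕ} (π : NCM n) (x y : ℕ) :
    2 * cntSeq (nestSeq p π) (p + x) y ≤ 2 * n - x := by
  refine le_trans ?_ (plus_ballot π x)
  rw [cnt_nest]
  have : (Finset.univ.filter fun i : Fin p =>
      p + x + 1 ≤ (i : ℕ) + 1 ∧ (i : ℕ) + 1 < y + 1) = ∅ := by
    ext i
    have := i.isLt
    simp only [Finset.mem_filter, Finset.mem_univ, true_and, Finset.notMem_empty, iff_false]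
    omega
  rw [this, Finset.card_empty, Nat.zero_add]
  refine Nat.mul_le_mul_left 2 (Finset.card_le_card ?_)
  intro i
  simp only [Finset.mem_filter, Finset.mem_univ, true_and]
  omega

theorem nest_eq (n : ℕ) (p : ℕ) (π : NCM n) (σ : NCM (n + p)) (τ : NCM n)
    (h : IsNest p τ σ) : CmatSeq (nestSeq p π) σ = CmatSeq (plus π) τ := by
  obtain ⟨h1, h2⟩ := h
  rw [Cmat_single, Cmat_single]
  symm
  refine Fintype.prod_of_injective
    (fun i : Fin (2 * n) => (⟨p + (i : ℕ), by have := i.isLt; omega⟩ : Fin (2 * (n + p))))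
    ?_ _ _ ?_ ?_
  · intro i j hij
    have := congrArg Fin.val hij
    simp only at this
    exact Fin.ext (by omega)
  · intro i hi
    by_cases hip : (i : ℕ) < p
    · have h3 := h1 i hip
      rw [pjk_cnt, h3, cnt_nest_out p π _ _ hip (by omega)]
      have e : ((n + (p - (i : ℕ)) : ℕ) : ℤ)
          - (((2 * (n + p) - 1 - (i : ℕ) - (i : ℕ) - 1) / 2 : ℕ) : ℤ) = 1 := by omega
      rw [e]
      simp [chi]
    · have hlt := i.isLt
      by_cases hi2 : (i : ℕ) < p + 2 * n
      · exact absurd ⟨⟨(i : ℕ) - p, by omega⟩, Fin.ext (by simp; omega)⟩ hi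
      · rw [if_neg]
        obtain ⟨j, hj⟩ : ∃ j : Fin (2 * (n + p)), (j : ℕ) = 2 * (n + p) - 1 - (i : ℕ) :=
          ⟨⟨2 * (n + p) - 1 - (i : ℕ), by omega⟩, rfl⟩
        have h3 := h1 j (by omega)
        have h4 : σ.f j = i := Fin.ext (by omega)
        rw [← h4, σ.invol, Fin.lt_def]
        omega
  · intro i
    simp only [Fin.lt_def, h2, pjk_cnt, cnt_nest_mid]
    have e : p + (τ.f i : ℕ) - (p + (i : ℕ)) - 1 = (τ.f i : ℕ) - (i : ℕ) - 1 := by omega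
    rw [e]
    simp only [Nat.add_lt_add_iff_left]

theorem nest_exists (n : ℕ) (p : ℕ) (π : NCM n) (σ : NCM (n + p))
    (hne : CmatSeq (nestSeq p π) σ ≠ 0) : ∃ τ : NCM n, IsNest p τ σ := by
  rw [Cmat_single, Finset.prod_ne_zero_iff] at hne
  have h : ∀ j : Fin (2 * (n + p)), j < σ.f j →
      pjkSeq (nestSeq p π) ((j : ℕ) + 1) ((σ.f j : ℕ) + 1) ≠ 0 := by
    intro j hj h0
    have := hne j (Finset.mem_univ _)
    rw [if_pos hj, h0] at this
    simp [chi] at this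
  have harc := arc_count σ _ h
  have key : ∀ j : Fin (2 * (n + p)), j < σ.f j → p + 2 * n ≤ (σ.f j : ℕ) →
      (j : ℕ) < p ∧ (j : ℕ) + (σ.f j : ℕ) + 1 ≤ 2 * (n + p) := by
    intro j hj hk
    have h1 := harc j hj
    rw [Fin.lt_def] at hj
    by_cases hjp : (j : ℕ) < p
    · rw [cnt_nest_out p π _ _ hjp hk] at h1
      omega
    · have h2 := cnt_nest_le p π ((j : ℕ) - p) (σ.f j : ℕ)
      rw [Nat.add_sub_cancel' (not_lt.1 hjp)] at h2
      omega
  have hlast : ∀ i : ℕ, ∀ k : Fin (2 * (n + p)), i < p → (k : ℕ) + i + 1 = 2 * (n + p) →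
      (σ.f k : ℕ) = i := by
    intro i
    induction i using Nat.strong_induction_on with
    | _ i ih =>
      intro k hi hk
      have hnf : (σ.f k : ℕ) ≠ k := fun h' => σ.nofix k (Fin.ext h')
      have hle : (σ.f k : ℕ) ≤ i := by
        rcases Nat.lt_or_ge (σ.f k : ℕ) k with hlt | hge
        · have := key (σ.f k) (by rw [σ.invol, Fin.lt_def]; exact hlt)
            (by rw [σ.invol]; omega)
          rw [σ.invol] at this
          omega
        · have := key k (by rw [Fin.lt_def]; omega) (by omega)
          omega
      by_contra hcon
      have hlt : (σ.f k : ℕ) < i := by omega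
      obtain ⟨k', hk'⟩ : ∃ k' : Fin (2 * (n + p)), (k' : ℕ) + (σ.f k : ℕ) + 1 = 2 * (n + p) :=
        ⟨⟨2 * (n + p) - 1 - (σ.f k : ℕ), by omega⟩, by simp only; omega⟩
      have h5 := ih _ hlt k' (by omega) hk'
      have := congrArg Fin.val (σ.inj (Fin.ext h5))
      omega
  have hfirst : ∀ i : Fin (2 * (n + p)), (i : ℕ) < p →
      (σ.f i : ℕ) = 2 * (n + p) - 1 - (i : ℕ) := by
    intro i hi
    obtain ⟨k, hk⟩ : ∃ k : Fin (2 * (n + p)), (k : ℕ) + (i : ℕ) + 1 = 2 * (n + p) :=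
      ⟨⟨2 * (n + p) - 1 - (i : ℕ), by omega⟩, by simp only; omega⟩
    have h5 := hlast _ k hi hk
    have h6 : σ.f k = i := Fin.ext h5
    rw [← h6, σ.invol]
    omega
  have hmid : ∀ i : Fin (2 * (n + p)), p ≤ (i : ℕ) → (i : ℕ) < p + 2 * n →
      p ≤ (σ.f i : ℕ) ∧ (σ.f i : ℕ) < p + 2 * n := by
    intro i hi1 hi2
    constructor
    · by_contra hc
      have := hfirst (σ.f i) (by omega)
      rw [σ.invol] at this
      omega
    · by_contra hc
      have h7 := (σ.f i).isLt
      have := hlast (2 * (n + p) - 1 - (σ.f i : ℕ)) (σ.f i) (by omega) (by omega)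
      rw [σ.invol] at this
      omega
  let u : Fin (2 * n) → Fin (2 * (n + p)) :=
    fun i => ⟨p + (i : ℕ), by have := i.isLt; omega⟩
  have huv : ∀ i, (u i : ℕ) = p + (i : ℕ) := fun i => rfl
  have hu : ∀ i, p ≤ (σ.f (u i) : ℕ) ∧ (σ.f (u i) : ℕ) < p + 2 * n := by
    intro i
    have := i.isLt
    exact hmid (u i) (by rw [huv]; omega) (by rw [huv]; omega)
  let g : Fin (2 * n) → Fin (2 * n) :=
    fun i => ⟨(σ.f (u i) : ℕ) - p, by have := hu i; omega⟩
  have hg : ∀ i, u (g i) = σ.f (u i) := by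
    intro i
    apply Fin.ext
    have := hu i
    simp only [u, g] at this ⊢
    omega
  have huinj : ∀ i j, u i = u j → i = j := by
    intro i j hij
    have := congrArg Fin.val hij
    rw [huv, huv] at this
    exact Fin.ext (by omega)
  have hult : ∀ i j, i < j → u i < u j := by
    intro i j hij
    rw [Fin.lt_def] at hij ⊢
    rw [huv, huv]; omega
  refine ⟨⟨g, ?_, ?_, ?_⟩, hfirst, ?_⟩
  · intro k
    apply huinj
    rw [hg, hg, σ.invol]
  · intro k hk
    apply σ.nofix (u k)
    rw [← hg, hk]
  · intro a b c d hab hbc hcd hac hbd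
    refine σ.noncross (u a) (u b) (u c) (u d) (hult _ _ hab) (hult _ _ hbc) (hult _ _ hcd) ?_ ?_
    · rw [← hg, hac]
    · rw [← hg, hbd]
  · intro i
    have := congrArg Fin.val (hg i)
    rw [huv] at this
    exact this.symm

/-- Nesting invariance of the coefficients `C` (equation (2.23)):
`C_{⟨a⟩^p, σ} = C_{a,τ}` if `σ = ⟨τ⟩^p`, and `C_{⟨a⟩^p, σ} = 0` if `σ` is not a
`p`-nesting. -/
theorem Cmat_nesting (n : ℕ) (hn : 1 ≤ n) (p : ℕ) (π : NCM n) (σ : NCM (n + p)) :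
    (∀ τ : NCM n, IsNest p τ σ → CmatSeq (nestSeq p π) σ = CmatSeq (plus π) τ) ∧
    ((∀ τ : NCM n, ¬ IsNest p τ σ) → CmatSeq (nestSeq p π) σ = 0) := by
  exact ⟨fun τ h => nest_eq n p π σ τ h, fun h => by
    by_contra hne
    obtain ⟨τ, hτ⟩ := nest_exists n p π σ hne
    exact h τ hτ⟩
end

section
/- Let n ≥ 1, let p be a wheel polynomial of order n, let 1 ≤ j ≤ 2n−1, and suppose r ∈ ℂ[z_1,…,z_{2n}] satisfies (z_{j+1} − z_j)·r = p^{(j)} − p, where p^{(j)} denotes the polynomial obtained from p by exchanging the variables z_j and z_{j+1}. Then (q·z_j − q⁻¹·z_{j+1})·r is again a wheel polynomial of order n. -/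
open scoped BigOperators

open MvPolynomial

attribute [local instance 10] Classical.propDecidable

theorem q_ne_zero' : q ≠ 0 := Complex.exp_ne_zero _

/-- If `l * r` is homogeneous of degree `N`, with `l ≠ 0` and `l'` linear forms,
then so is `l' * r`. -/
theorem homog_aux {σ : Type*} {N : ℕ} (l l' r : MvPolynomial σ ℂ) (hl0 : l ≠ 0)
    (hl : l.IsHomogeneous 1) (hl' : l'.IsHomogeneous 1) (h : (l * r).IsHomogeneous N) :
    (l' * r).IsHomogeneous N := by
  have key : ∀ k, homogeneousComponent (1 + k) (l * r) = l * homogeneousComponent k r := by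
    intro k
    conv_lhs => rw [← sum_homogeneousComponent r, Finset.mul_sum, map_sum]
    have h1 : ∀ i ∈ Finset.range (r.totalDegree + 1),
        homogeneousComponent (1 + k) (l * homogeneousComponent i r) =
          if i = k then l * homogeneousComponent k r else 0 := by
      intro i _
      rw [homogeneousComponent_of_mem (hl.mul (homogeneousComponent_isHomogeneous i r))]
      by_cases hik : i = k
      · subst hik; simp
      · have : ¬ (1 + k = 1 + i) := by omega
        rw [if_neg this, if_neg hik]
    rw [Finset.sum_congr rfl h1, Finset.sum_ite_eq']
    split_ifs with hk
    · rfl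
    · rw [homogeneousComponent_eq_zero, mul_zero]
      simp at hk; omega
  rw [← sum_homogeneousComponent r, Finset.mul_sum]
  apply IsHomogeneous.sum
  intro i _
  by_cases hi : 1 + i = N
  · rw [← hi]
    exact hl'.mul (homogeneousComponent_isHomogeneous i r)
  · have h2 := key i
    rw [homogeneousComponent_of_mem h, if_neg hi] at h2
    have h3 := (mul_eq_zero.mp h2.symm).resolve_left hl0
    rw [h3, mul_zero]
    exact isHomogeneous_zero _ _ _

/-- The wheel substitution. -/
noncomputable def wheelSub {m : ℕ} (a b c : Fin m) (l : Fin m) : MvPolynomial (Fin m) ℂ :=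
  if l = b then C (q ^ 2) * X a
  else if l = c then C (q ^ 4) * X a
  else X l

theorem wheelSub_swap {m : ℕ} (s t a b c : Fin m) (p : MvPolynomial (Fin m) ℂ)
    (h : aeval (wheelSub (Equiv.swap s t a) (Equiv.swap s t b) (Equiv.swap s t c)) p = 0) :
    aeval (wheelSub a b c) (rename (Equiv.swap s t) p) = 0 := by
  have h2 := congrArg (rename (R := ℂ) (Equiv.swap s t)) h
  rw [map_zero, ← AlgHom.comp_apply, comp_aeval] at h2
  rw [aeval_rename, ← h2]
  congr 2
  funext l
  have e : ∀ x, (l = Equiv.swap s t x) ↔ (Equiv.swap s t l = x) := by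
    intro x
    constructor
    · rintro rfl; simp
    · rintro rfl; simp
  simp only [wheelSub, Function.comp, e]
  split_ifs <;> simp

theorem wheelSub_ne {m : ℕ} (a b c u v : Fin m) (huv : u ≠ v)
    (ha : u ≠ a) (hb : u ≠ b) (hc : u ≠ c) :
    wheelSub a b c u ≠ wheelSub a b c v := by
  intro h
  have h2 := congrArg (eval (fun x => if x = u then (1 : ℂ) else 0)) h
  simp only [wheelSub, if_neg hb, if_neg hc] at h2
  split_ifs at h2 <;> simp [ha.symm, huv.symm] at h2

/-- Lemma 2.6: if `p` is a wheel polynomial and `r = ∂_j p` is its divided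
difference, then `(q z_j - q⁻¹ z_{j+1}) · r` is again a wheel polynomial. -/
theorem divided_difference_wheel (n : ℕ) (hn : 1 ≤ n)
    (p : MvPolynomial (Fin (2 * n)) ℂ) (hp : IsWheel n p)
    (j : ℕ) (hj : j + 1 < 2 * n) (r : MvPolynomial (Fin (2 * n)) ℂ)
    (hr : (X (⟨j + 1, hj⟩ : Fin (2 * n)) - X ⟨j, by omega⟩) * r =
        rename (Equiv.swap (⟨j, by omega⟩ : Fin (2 * n)) ⟨j + 1, hj⟩) p - p) :
    IsWheel n
      ((C q * X (⟨j, by omega⟩ : Fin (2 * n)) - C q⁻¹ * X ⟨j + 1, hj⟩) * r) := by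
  set s : Fin (2 * n) := ⟨j, by omega⟩ with hs
  set t : Fin (2 * n) := ⟨j + 1, hj⟩ with ht
  have hst : s ≠ t := by simp [hs, ht]
  have hX : (X t - X s : MvPolynomial (Fin (2 * n)) ℂ) ≠ 0 := by
    intro h
    exact hst (X_injective (sub_eq_zero.mp h)).symm
  obtain ⟨hp1, hp2⟩ := hp
  constructor
  · refine homog_aux (X t - X s) _ r hX ((isHomogeneous_X _ _).sub (isHomogeneous_X _ _))
      ((isHomogeneous_C_mul_X _ _).sub (isHomogeneous_C_mul_X _ _)) ?_
    rw [hr]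
    exact hp1.rename_isHomogeneous.sub hp1
  · intro a b c hab hbc
    change aeval (wheelSub a b c) _ = 0
    have hp3 : ∀ a b c : Fin (2 * n), a < b → b < c → aeval (wheelSub a b c) p = 0 := hp2
    rw [map_mul]
    by_cases h1 : s = a ∧ t = b
    · obtain ⟨rfl, rfl⟩ := h1
      have : s ≠ c := (hab.trans hbc).ne
      have e : q⁻¹ * q ^ 2 = q := by have := q_ne_zero'; field_simp
      simp only [map_sub, map_mul, aeval_X, wheelSub, algHom_C, algebraMap_eq, hst, this,
        if_true, if_false]
      rw [← mul_assoc, ← C_mul, e, sub_self, zero_mul]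
    by_cases h2 : s = b ∧ t = c
    · obtain ⟨rfl, rfl⟩ := h2
      have e : q⁻¹ * q ^ 4 = q * q ^ 2 := by have := q_ne_zero'; field_simp
      simp only [map_sub, map_mul, aeval_X, wheelSub, algHom_C, algebraMap_eq, hst.symm,
        if_true, if_false]
      rw [← mul_assoc, ← mul_assoc, ← C_mul, ← C_mul, e, sub_self, zero_mul]
    have hsv : s.val = j := rfl
    have htv : t.val = j + 1 := rfl
    have h3 := congrArg (aeval (wheelSub a b c)) hr
    have hsw : aeval (wheelSub a b c) (rename (Equiv.swap s t) p) = 0 := by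
      apply wheelSub_swap
      apply hp3
      · simp only [Equiv.swap_apply_def]
        split_ifs <;> simp only [Fin.lt_def, Fin.ext_iff] at * <;> omega
      · simp only [Equiv.swap_apply_def]
        split_ifs <;> simp only [Fin.lt_def, Fin.ext_iff] at * <;> omega
    rw [map_mul, map_sub, map_sub, hsw, hp3 a b c hab hbc, sub_zero, aeval_X, aeval_X] at h3
    have hne : wheelSub a b c t - wheelSub a b c s ≠ 0 := by
      rw [sub_ne_zero]
      by_cases h4 : s ≠ a ∧ s ≠ b ∧ s ≠ c
      · exact (wheelSub_ne a b c s t hst h4.1 h4.2.1 h4.2.2).symm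
      · apply wheelSub_ne a b c t s hst.symm
        all_goals
          clear h3 hsw hp2 hp3 hp1 hr hX
          simp only [Fin.lt_def, Fin.ext_iff, ne_eq] at *
          omega
    rw [(mul_eq_zero.mp h3).resolve_left hne, mul_zero]
end
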